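/- arXiv:0902.2300 — 2 statements merged into one kernel-verified Lean document; each statement's English description precedes it below -/
import Mathlib

section
/- For every natural number n and every n×n matrix A over a commutative ring R, let G''_n be the incidence graph of the incidence graph of G'_n, where G'_n carries the vertex weights w(i,j) = A i j and each application of the incidence-graph construction assigns weight −1 to the newly added vertices. Then G''_n is bipartite and IP(G''_n, ŵ) = PER*(A). -/
attribute [local instance] Classical.propDecidable

/-- The partial permanent of an `n × n` matrix: the sum, over all injective partial maps
`π` from `Fin n` to `Fin n`, of the products `∏_{i ∈ dom π} A i (π i)`. -/
noncomputable def partialPerm {n : ℕ} {R : Type*} [CommRing R]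
    (A : Matrix (Fin n) (Fin n) R) : R :=
  ∑ f ∈ Finset.univ.filter
      (fun f : Fin n → Option (Fin n) => ∀ i j k, f i = some k → f j = some k → i = j),
    ∏ i, (f i).elim 1 (fun j => A i j)

/-- The independent set polynomial of a vertex-weighted finite graph. -/
noncomputable def indepPoly {V : Type*} [Fintype V] {R : Type*} [CommRing R]
    (G : SimpleGraph V) (w : V → R) : R :=
  ∑ S ∈ Finset.univ.filter (fun S : Finset V => ∀ a ∈ S, ∀ b ∈ S, ¬ G.Adj a b),
    ∏ v ∈ S, w v

/-- The vertex cover polynomial of a vertex-weighted finite graph. -/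
noncomputable def vcPoly {V : Type*} [Fintype V] {R : Type*} [CommRing R]
    (G : SimpleGraph V) (w : V → R) : R :=
  ∑ C ∈ Finset.univ.filter (fun C : Finset V => ∀ a b, G.Adj a b → a ∈ C ∨ b ∈ C),
    ∏ v ∈ C, w v

/-- The graph `G'_n` on vertex set `Fin n × Fin n`, two distinct vertices being adjacent
iff they share a coordinate. -/
def Gn (n : ℕ) : SimpleGraph (Fin n × Fin n) :=
  SimpleGraph.fromRel (fun p q => p.1 = q.1 ∨ p.2 = q.2)

/-- The incidence graph of a simple graph `G`: the bipartite graph on `V ⊕ G.edgeSet`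
in which an edge-vertex `e` is adjacent to a vertex `v` iff `v` is an endpoint of `e`. -/
def incidenceGraph {V : Type*} (G : SimpleGraph V) :
    SimpleGraph (V ⊕ ↥G.edgeSet) :=
  SimpleGraph.fromRel (fun a b =>
    match a, b with
    | Sum.inl v, Sum.inr e => v ∈ (e : Sym2 V)
    | _, _ => False)

section IncidenceGraph

variable {V : Type*} (G : SimpleGraph V)

@[simp]
theorem incidenceGraph_adj_inl_inr (v : V) (e : G.edgeSet) :
    (incidenceGraph G).Adj (Sum.inl v) (Sum.inr e) ↔ v ∈ (e : Sym2 V) := by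
  simp [incidenceGraph]

@[simp]
theorem incidenceGraph_adj_inr_inl (v : V) (e : G.edgeSet) :
    (incidenceGraph G).Adj (Sum.inr e) (Sum.inl v) ↔ v ∈ (e : Sym2 V) := by
  simp [incidenceGraph]

@[simp]
theorem incidenceGraph_not_adj_inl_inl (u v : V) :
    ¬ (incidenceGraph G).Adj (Sum.inl u) (Sum.inl v) := by
  simp [incidenceGraph]

@[simp]
theorem incidenceGraph_not_adj_inr_inr (e f : G.edgeSet) :
    ¬ (incidenceGraph G).Adj (Sum.inr e) (Sum.inr f) := by
  simp [incidenceGraph]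

theorem incidenceGraph_colorable_two : (incidenceGraph G).Colorable 2 := by
  refine ⟨SimpleGraph.Coloring.mk (Sum.elim (fun _ => 0) (fun _ => 1)) ?_⟩
  rintro (u | e) (v | f) <;> simp

end IncidenceGraph

section SumOverSubsets

variable {α β R : Type*} [Fintype α] [Fintype β]

theorem Finset.sum_univ_finset_sum [AddCommMonoid R] (F : Finset (α ⊕ β) → R) :
    ∑ S, F S = ∑ S : Finset α, ∑ T : Finset β, F (S.disjSum T) := by
  rw [← Fintype.sum_prod_type']
  exact (Equiv.sum_comp (Finset.sumEquiv (α := α) (β := β)).symm.toEquiv F).symm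

/-- The alternating sum over the subsets of `{b | p b}` vanishes unless this set is empty. -/
theorem sum_ite_forall_mem_neg_one_pow [CommRing R] (p : β → Prop) :
    ∑ T : Finset β, (if ∀ b ∈ T, p b then (-1 : R) ^ T.card else 0)
      = if ∀ b, ¬ p b then 1 else 0 := by
  have h := Finset.prod_add (fun b => if p b then (-1 : R) else 0) (fun _ => 1) Finset.univ
  simp only [Finset.powerset_univ, Finset.prod_const_one, mul_one] at h
  calc _ = ∑ T : Finset β, ∏ b ∈ T, (if p b then (-1 : R) else 0) := by
        refine Finset.sum_congr rfl fun T _ => ?_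
        rw [Finset.prod_ite_zero, Finset.prod_const]
        congr
    _ = ∏ b, (if ¬ p b then (1 : R) else 0) := by
        rw [← h]
        refine Finset.prod_congr rfl fun b _ => ?_
        by_cases hb : p b <;> simp [hb]
    _ = _ := by
        simp only [Finset.prod_ite_zero, Finset.mem_univ, true_imp_iff, Finset.prod_const_one]

/-- The alternating sum over the sets containing `{b | p b}` vanishes unless this set is
everything. -/
theorem sum_ite_forall_imp_mem_neg_one_pow [CommRing R] (p : β → Prop) :
    ∑ T : Finset β, (if ∀ b, p b → b ∈ T then (-1 : R) ^ T.card else 0)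
      = if ∀ b, p b then (-1) ^ Fintype.card β else 0 := by
  have h := Finset.prod_add (fun _ => (-1 : R)) (fun b => if ¬ p b then (1 : R) else 0)
    Finset.univ
  simp only [Finset.powerset_univ, Finset.prod_const, Finset.prod_ite_zero] at h
  calc _ = ∏ b, (if p b then (-1 : R) else 0) := by
        rw [Finset.prod_congr rfl (fun b _ => show (if p b then (-1 : R) else 0)
          = -1 + if ¬ p b then (1 : R) else 0 by by_cases hb : p b <;> simp [hb]), h]
        refine Finset.sum_congr rfl fun T _ => ?_
        have : (∀ b, p b → b ∈ T) ↔ ∀ b ∈ Finset.univ \ T, ¬ p b := by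
          simp only [Finset.mem_sdiff, Finset.mem_univ, true_and]
          exact forall_congr' fun b => by tauto
        simp [this]
    _ = _ := by simp [Finset.prod_ite_zero]

end SumOverSubsets

section Polynomials

variable {V R : Type*} [Fintype V] [CommRing R] (G : SimpleGraph V) [Fintype G.edgeSet]
  (w : V → R)

theorem indepPoly_incidenceGraph :
    indepPoly (incidenceGraph G) (Sum.elim w (fun _ => -1)) = vcPoly G w := by
  rw [indepPoly, vcPoly, Finset.sum_filter, Finset.sum_univ_finset_sum, Finset.sum_filter]
  refine Finset.sum_congr rfl fun S _ => ?_
  have h (T : Finset G.edgeSet) :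
      (∀ a ∈ S.disjSum T, ∀ b ∈ S.disjSum T, ¬ (incidenceGraph G).Adj a b) ↔
        ∀ e ∈ T, ∀ v ∈ S, v ∉ (e : Sym2 V) := by
    simp only [Sum.forall, Finset.inl_mem_disjSum, Finset.inr_mem_disjSum,
      incidenceGraph_adj_inl_inr, incidenceGraph_adj_inr_inl, incidenceGraph_not_adj_inl_inl,
      incidenceGraph_not_adj_inr_inr, not_false_eq_true, implies_true, true_and, and_true]
    exact ⟨fun h => h.2, fun h => ⟨fun v hv e he => h e he v hv, h⟩⟩
  have h' : (∀ e : G.edgeSet, ¬ ∀ v ∈ S, v ∉ (e : Sym2 V)) ↔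
      ∀ a b, G.Adj a b → a ∈ S ∨ b ∈ S := by
    simp only [Subtype.forall, Sym2.forall, SimpleGraph.mem_edgeSet, Sym2.mem_iff]
    refine forall₃_congr fun a b _ => ?_
    push Not
    constructor
    · rintro ⟨v, hv, rfl | rfl⟩ <;> simp [hv]
    · rintro (ha | hb)
      exacts [⟨a, ha, .inl rfl⟩, ⟨b, hb, .inr rfl⟩]
  simp only [h, Finset.prod_disjSum, Sum.elim_inl, Sum.elim_inr, Finset.prod_const]
  have key := sum_ite_forall_mem_neg_one_pow (R := R)
    (fun e : G.edgeSet => ∀ v ∈ S, v ∉ (e : Sym2 V))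
  simp only [h'] at key
  simpa [Finset.mul_sum, mul_ite] using congrArg ((∏ v ∈ S, w v) * ·) key

theorem vcPoly_incidenceGraph :
    vcPoly (incidenceGraph G) (Sum.elim w (fun _ => -1))
      = (-1) ^ Fintype.card G.edgeSet * indepPoly G w := by
  rw [indepPoly, vcPoly, Finset.sum_filter, Finset.sum_univ_finset_sum, Finset.sum_filter,
    Finset.mul_sum]
  refine Finset.sum_congr rfl fun S _ => ?_
  have h (T : Finset G.edgeSet) :
      (∀ a b, (incidenceGraph G).Adj a b → a ∈ S.disjSum T ∨ b ∈ S.disjSum T) ↔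
        ∀ e : G.edgeSet, (∃ v ∈ (e : Sym2 V), v ∉ S) → e ∈ T := by
    simp only [Sum.forall, Finset.inl_mem_disjSum, Finset.inr_mem_disjSum,
      incidenceGraph_adj_inl_inr, incidenceGraph_adj_inr_inl, incidenceGraph_not_adj_inl_inl,
      incidenceGraph_not_adj_inr_inr, false_imp_iff, implies_true, true_and, and_true]
    constructor
    · rintro h e ⟨v, hv, hS⟩
      exact (h.1 v e hv).resolve_left hS
    · intro h
      have (e : G.edgeSet) (v : V) (hv : v ∈ (e : Sym2 V)) : e ∈ T ∨ v ∈ S :=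
        or_iff_not_imp_right.2 fun hS => h e ⟨v, hv, hS⟩
      exact ⟨fun v e hv => (this e v hv).symm, this⟩
  have h' : (∀ e : G.edgeSet, ∃ v ∈ (e : Sym2 V), v ∉ S) ↔
      ∀ a ∈ S, ∀ b ∈ S, ¬ G.Adj a b := by
    simp only [Subtype.forall, Sym2.forall, SimpleGraph.mem_edgeSet, Sym2.mem_iff]
    constructor
    · rintro h a ha b hb hab
      obtain ⟨v, rfl | rfl, hv⟩ := h a b hab
      exacts [hv ha, hv hb]
    · intro h a b hab
      by_cases ha : a ∈ S
      exacts [⟨b, .inr rfl, fun hb => h a ha b hb hab⟩, ⟨a, .inl rfl, ha⟩]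
  simp only [h, Finset.prod_disjSum, Sum.elim_inl, Sum.elim_inr, Finset.prod_const]
  have key := sum_ite_forall_imp_mem_neg_one_pow (R := R)
    (fun e : G.edgeSet => ∃ v ∈ (e : Sym2 V), v ∉ S)
  simp only [h'] at key
  simpa only [Finset.mul_sum, mul_ite, ite_mul, mul_zero, zero_mul, mul_comm] using
    congrArg ((∏ v ∈ S, w v) * ·) key

end Polynomials

section RookGraph

theorem Gn_adj {n : ℕ} (p q : Fin n × Fin n) :
    (Gn n).Adj p q ↔ p ≠ q ∧ (p.1 = q.1 ∨ p.2 = q.2) := by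
  simp only [Gn, SimpleGraph.fromRel_adj]
  grind

/-- Swapping coordinates is a fixed-point-free involution on the edges of `Gn n`. -/
theorem neg_one_pow_card_edgeSet_Gn (n : ℕ) (R : Type*) [CommRing R]
    [Fintype (Gn n).edgeSet] : (-1 : R) ^ Fintype.card (Gn n).edgeSet = 1 := by
  rw [← SimpleGraph.edgeFinset_card, ← Finset.prod_const]
  refine Finset.prod_involution (fun e _ => Sym2.map Prod.swap e) (by simp) ?_ ?_ ?_
  · rintro e he -
    induction e with | _ p q
    obtain ⟨a, b⟩ := p
    obtain ⟨c, d⟩ := q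
    simp only [SimpleGraph.mem_edgeFinset, SimpleGraph.mem_edgeSet, Gn_adj, ne_eq,
      Prod.mk.injEq] at he
    simp only [Sym2.map_mk, Prod.swap, ne_eq, Sym2.eq_iff, Prod.mk.injEq]
    grind
  · intro e he
    induction e with | _ p q
    simp only [Sym2.map_mk, SimpleGraph.mem_edgeFinset, SimpleGraph.mem_edgeSet, Gn_adj, ne_eq,
      Prod.swap_inj, Prod.fst_swap, Prod.snd_swap] at he ⊢
    exact ⟨he.1, he.2.symm⟩
  · intro e _
    simp [Sym2.map_map]

theorem indepPoly_Gn {n : ℕ} {R : Type*} [CommRing R] (A : Matrix (Fin n) (Fin n) R) :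
    indepPoly (Gn n) (fun p => A p.1 p.2) = partialPerm A := by
  symm
  refine Finset.sum_bij (fun f _ => Finset.univ.filter fun p : Fin n × Fin n => f p.1 = some p.2)
    ?_ ?_ ?_ ?_
  · intro f hf
    simp only [Finset.mem_filter, Finset.mem_univ, true_and, Gn_adj, Prod.forall] at hf ⊢
    grind
  · intro f _ g _ hfg
    funext i
    refine Option.ext fun j => ?_
    simpa using Finset.ext_iff.1 hfg (i, j)
  · intro S hS
    simp only [Finset.mem_filter, Finset.mem_univ, true_and, Gn_adj, Prod.forall] at hS
    let f (i : Fin n) : Option (Fin n) :=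
      if h : ∃ j, (i, j) ∈ S then some h.choose else none
    have hf (i j : Fin n) : f i = some j ↔ (i, j) ∈ S := by
      by_cases h : ∃ j, (i, j) ∈ S
      · have hc := h.choose_spec
        simp only [f, dif_pos h, Option.some.injEq]
        grind
      · simp only [f, dif_neg h]
        grind
    refine ⟨f, ?_, ?_⟩
    · simp only [Finset.mem_filter, Finset.mem_univ, true_and, hf]
      grind
    · ext ⟨i, j⟩
      simp [hf]
  · intro f _
    rw [Finset.prod_filter, Fintype.prod_prod_type]
    refine Finset.prod_congr rfl fun i _ => ?_
    cases h : f i <;> simp [h]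

end RookGraph

theorem stmt7 {n : ℕ} {R : Type*} [CommRing R] (A : Matrix (Fin n) (Fin n) R) :
    (incidenceGraph (incidenceGraph (Gn n))).Colorable 2 ∧
    indepPoly (incidenceGraph (incidenceGraph (Gn n)))
        (Sum.elim (Sum.elim (fun p => A p.1 p.2) (fun _ => -1)) (fun _ => -1))
      = partialPerm A := by
  refine ⟨incidenceGraph_colorable_two _, ?_⟩
  rw [indepPoly_incidenceGraph, vcPoly_incidenceGraph, neg_one_pow_card_edgeSet_Gn, one_mul,
    indepPoly_Gn]
end

section
/- Let V1 and V2 be finite sets with |V1| even, let r be a relation with r x y only for x ∈ V1 and y ∈ V2, and let ≤ be the partial order on the disjoint union V1 ⊕ V2 defined by u ≤ v iff u = v, or u ∈ V1, v ∈ V2 and r u v. Let w be a weight function on V1 ⊕ V2 with values in a commutative ring such that w x = −1 for every x ∈ V1. Then the sum over all antichains A of ∏_{x∈A} w x equals the sum over all lower sets I of ∏_{x∈I} w x. -/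
attribute [local instance] Classical.propDecidable

/-- The partial order on `V1 ⊕ V2` in which `u ≤ v` iff `u = v`, or `u ∈ V1`, `v ∈ V2`
and `r u v`. -/
def sumOrder {V1 V2 : Type*} (r : V1 → V2 → Prop) : PartialOrder (V1 ⊕ V2) where
  le a b := a = b ∨ ∃ x y, a = Sum.inl x ∧ b = Sum.inr y ∧ r x y
  le_refl a := Or.inl rfl
  le_trans a b c hab hbc := by
    rcases hab with rfl | ⟨x, y, rfl, rfl, hxy⟩
    · exact hbc
    · rcases hbc with h | ⟨x', y', h, _, _⟩
      · exact Or.inr ⟨x, y, rfl, h.symm, hxy⟩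
      · simp at h
  le_antisymm a b hab hba := by
    rcases hab with rfl | ⟨x, y, rfl, rfl, hxy⟩
    · rfl
    · rcases hba with h | ⟨x', y', h, _, _⟩
      · exact h.symm
      · simp at h

/-- Complement the part of a subset of `V1 ⊕ V2` that lies in `V1`, and keep the rest. -/
noncomputable def complLeft {V1 V2 : Type*} [Fintype V1] (A : Finset (V1 ⊕ V2)) :
    Finset (V1 ⊕ V2) :=
  A.toLeftᶜ.disjSum A.toRight

@[simp]
theorem inl_mem_complLeft {V1 V2 : Type*} [Fintype V1] {A : Finset (V1 ⊕ V2)} {x : V1} :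
    Sum.inl x ∈ complLeft A ↔ Sum.inl x ∉ A := by
  simp [complLeft]

@[simp]
theorem inr_mem_complLeft {V1 V2 : Type*} [Fintype V1] {A : Finset (V1 ⊕ V2)} {y : V2} :
    Sum.inr y ∈ complLeft A ↔ Sum.inr y ∈ A := by
  simp [complLeft]

@[simp]
theorem complLeft_complLeft {V1 V2 : Type*} [Fintype V1] (A : Finset (V1 ⊕ V2)) :
    complLeft (complLeft A) = A := by
  ext (x | y) <;> simp

theorem prod_complLeft {V1 V2 : Type*} [Fintype V1] {R : Type*} [CommRing R]
    (hV1 : Even (Fintype.card V1)) (w : V1 ⊕ V2 → R) (hw : ∀ x : V1, w (Sum.inl x) = -1)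
    (A : Finset (V1 ⊕ V2)) : ∏ x ∈ complLeft A, w x = ∏ x ∈ A, w x := by
  have hsign : (-1 : R) ^ A.toLeftᶜ.card = (-1) ^ A.toLeft.card := by
    have hcard := A.toLeft.card_add_card_compl
    apply neg_one_pow_congr
    grind
  conv_rhs => rw [← Finset.toLeft_disjSum_toRight (u := A)]
  simp only [complLeft, Finset.prod_disjSum, hw, Finset.prod_const, hsign]

theorem isAntichain_sumOrder_iff {V1 V2 : Type*} (r : V1 → V2 → Prop)
    (A : Finset (V1 ⊕ V2)) :
    IsAntichain (sumOrder r).le (A : Set (V1 ⊕ V2)) ↔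
      ∀ x y, r x y → Sum.inr y ∈ A → Sum.inl x ∉ A := by
  constructor
  · intro h x y hxy hy hx
    exact h hx hy Sum.inl_ne_inr (Or.inr ⟨x, y, rfl, rfl, hxy⟩)
  · rintro h a ha b hb hab (hle | ⟨x, y, rfl, rfl, hxy⟩)
    · exact hab hle
    · exact h x y hxy hb ha

theorem lowerSet_sumOrder_iff {V1 V2 : Type*} (r : V1 → V2 → Prop) (I : Finset (V1 ⊕ V2)) :
    (∀ a b, (sumOrder r).le a b → b ∈ I → a ∈ I) ↔
      ∀ x y, r x y → Sum.inr y ∈ I → Sum.inl x ∈ I := by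
  constructor
  · intro h x y hxy
    exact h _ _ (Or.inr ⟨x, y, rfl, rfl, hxy⟩)
  · rintro h a b (rfl | ⟨x, y, rfl, rfl, hxy⟩)
    · exact id
    · exact h x y hxy

theorem stmt10 {V1 V2 : Type*} [Fintype V1] [Fintype V2] {R : Type*} [CommRing R]
    (hV1 : Even (Fintype.card V1)) (r : V1 → V2 → Prop)
    (w : V1 ⊕ V2 → R) (hw : ∀ x : V1, w (Sum.inl x) = -1) :
    letI : PartialOrder (V1 ⊕ V2) := sumOrder r
    ∑ A ∈ Finset.univ.filter
        (fun A : Finset (V1 ⊕ V2) => IsAntichain (· ≤ ·) (A : Set (V1 ⊕ V2))),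
      ∏ x ∈ A, w x
    = ∑ I ∈ Finset.univ.filter
        (fun I : Finset (V1 ⊕ V2) => ∀ a b : V1 ⊕ V2, a ≤ b → b ∈ I → a ∈ I),
      ∏ x ∈ I, w x := by
  refine Finset.sum_nbij' complLeft complLeft ?_ ?_ (fun A _ => complLeft_complLeft A)
    (fun I _ => complLeft_complLeft I) (fun A _ => (prod_complLeft hV1 w hw A).symm)
  · intro A hA
    have hanti := (isAntichain_sumOrder_iff r A).1 (Finset.mem_filter.1 hA).2
    refine Finset.mem_filter.2 ⟨Finset.mem_univ _, (lowerSet_sumOrder_iff r _).2 ?_⟩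
    simpa using hanti
  · intro I hI
    have hlower := (lowerSet_sumOrder_iff r I).1 (Finset.mem_filter.1 hI).2
    refine Finset.mem_filter.2 ⟨Finset.mem_univ _, (isAntichain_sumOrder_iff r _).2 ?_⟩
    simpa using hlower
end
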